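/- arXiv:1709.07073 — 5 statements merged into one kernel-verified Lean document; each statement's English description precedes it below -/
import Mathlib

section
/- Let A and Ω be closed, and let f and φ be lower semicontinuous on A. Then the linear penalty function F(x,c) = f(x) + cφ(x) is globally exact if and only if F(x,c) is locally exact at every globally optimal solution of the problem (P) and one of the following two conditions is satisfied: (1) F is non-degenerate; (2) there exists c₀ > 0 such that the set {x ∈ A : F(x,c₀) < f*} is bounded. -/
open Set Filter Topology

/-- The set of global minimizers of `g` on the set `A`. -/
def minimizersOn {X : Type*} (g : X → EReal) (A : Set X) : Set X :=
  {x ∈ A | ∀ y ∈ A, g x ≤ g y}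

/-- The set of globally optimal solutions of the problem (P):
minimize `f x` subject to `x ∈ M`, `x ∈ A`. -/
def optSet {X : Type*} (f : X → EReal) (M A : Set X) : Set X :=
  minimizersOn f (M ∩ A)

/-- The penalty function `F` is globally exact. -/
def GloballyExact {X : Type*} (f : X → EReal) (M A : Set X) (F : X → ℝ → EReal) : Prop :=
  ∃ cs > (0 : ℝ), ∀ c ≥ cs, minimizersOn (fun x => F x c) A = optSet f M A

/-- The penalty function `F` is locally exact at `x₀`. -/
def LocallyExact {X : Type*} [TopologicalSpace X] (A : Set X)
    (F : X → ℝ → EReal) (x₀ : X) : Prop :=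
  ∃ cs > (0 : ℝ), ∃ U ∈ 𝓝 x₀, ∀ c ≥ cs, ∀ x ∈ U ∩ A, F x₀ c ≤ F x c

/-- `F` is a penalty-type separating function. -/
def PenaltyType {X : Type*} [TopologicalSpace X] (f : X → EReal) (M A : Set X)
    (F : X → ℝ → EReal) : Prop :=
  ∃ c₀ > (0 : ℝ), ∀ cseq : ℕ → ℝ, StrictMono cseq → (∀ n, c₀ ≤ cseq n) →
    Tendsto cseq atTop atTop →
    ∀ xseq : ℕ → X, (∀ n, xseq n ∈ minimizersOn (fun x => F x (cseq n)) A) →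
    ∀ x₀ : X, MapClusterPt x₀ atTop xseq → x₀ ∈ optSet f M A

/-- `F` is non-degenerate. -/
def NonDegenerate {X : Type*} [NormedAddCommGroup X] (A : Set X)
    (F : X → ℝ → EReal) : Prop :=
  ∃ c₀ > (0 : ℝ), ∃ R > (0 : ℝ), ∀ c ≥ c₀,
    ∃ x ∈ minimizersOn (fun y => F y c) A, ‖x‖ ≤ R

/-- The linear penalty function `F(x, c) = f(x) + c·φ(x)`. -/
noncomputable def linPen {X : Type*} (f : X → EReal) (φ : X → EReal) (x : X) (c : ℝ) : EReal :=
  f x + (c : EReal) * φ x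

lemma linPen_of_mem_zero {X : Type*} (f φ : X → EReal) {x : X} (hx : φ x = 0) (c : ℝ) :
    linPen f φ x c = f x := by
  simp [linPen, hx]

lemma linPen_mono {X : Type*} (f φ : X → EReal) {x : X} (hx : 0 ≤ φ x) {c d : ℝ}
    (hcd : c ≤ d) : linPen f φ x c ≤ linPen f φ x d :=
  add_le_add_right (mul_le_mul_of_nonneg_right (EReal.coe_le_coe_iff.2 hcd) hx) _

lemma le_linPen {X : Type*} (f φ : X → EReal) {x : X} (hx : 0 ≤ φ x) {c : ℝ}
    (hc : 0 ≤ c) : f x ≤ linPen f φ x c := by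
  simpa [linPen] using linPen_mono f φ hx hc

/-- Where the infeasibility measure is positive, the linear penalty function is strictly
increasing in the penalty parameter, as soon as its values are finite. -/
lemma lt_linPen_of_le_linPen {X : Type*} {f φ : X → EReal} {x : X} {a : EReal}
    (ha : a ≠ ⊤) (hf : f x ≠ ⊥) (hφ : 0 < φ x) {c d : ℝ} (hc : 0 < c) (hcd : c < d)
    (h : a ≤ linPen f φ x c) : a < linPen f φ x d := by
  unfold linPen at *
  have hd : 0 < d := hc.trans hcd
  generalize f x = u at *
  generalize φ x = v at *
  induction v with
  | bot => simp at hφ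
  | top =>
    rw [EReal.coe_mul_top_of_pos hd, EReal.add_top_of_ne_bot hf]
    exact ha.lt_top
  | coe v =>
    induction u with
    | bot => exact absurd rfl hf
    | top =>
      rw [← EReal.coe_mul, EReal.top_add_coe]
      exact ha.lt_top
    | coe u =>
      refine h.trans_lt ?_
      have hv : 0 < v := by exact_mod_cast hφ
      norm_cast
      gcongr

/-- Near every point of `A` at which the penalty function is locally exact whenever the point is
optimal, some penalty parameter makes the penalty function at least the optimal value. -/
lemma exists_eventually_le_linPen {X : Type*} [TopologicalSpace X] {f φ : X → EReal}
    {M A : Set X} (hfbot : ∀ x, f x ≠ ⊥) (hφ : ∀ x, 0 ≤ φ x) (hφ0 : ∀ x, φ x = 0 ↔ x ∈ M)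
    (hf : LowerSemicontinuousOn f A) (hφlsc : LowerSemicontinuousOn φ A)
    {z : X} (hz : z ∈ optSet f M A) (hztop : f z ≠ ⊤)
    (hloc : ∀ x₀ ∈ optSet f M A, LocallyExact A (linPen f φ) x₀) {x : X} (hx : x ∈ A) :
    ∃ c > (0 : ℝ), ∀ᶠ y in 𝓝[A] x, f z ≤ linPen f φ y c := by
  by_cases hxo : x ∈ optSet f M A
  · obtain ⟨c, hc, U, hU, h⟩ := hloc x hxo
    refine ⟨c, hc, ?_⟩
    filter_upwards [mem_nhdsWithin_of_mem_nhds hU, self_mem_nhdsWithin] with y hyU hyA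
    refine (hz.2 x hxo.1).trans ?_
    simpa only [linPen_of_mem_zero f φ ((hφ0 x).2 hxo.1.1)] using h c le_rfl y ⟨hyU, hyA⟩
  by_cases hlt : f z < f x
  · refine ⟨1, one_pos, ?_⟩
    filter_upwards [hf x hx _ hlt] with y hy
    exact hy.le.trans (le_linPen f φ (hφ y) zero_le_one)
  have hxM : x ∉ M := fun hxM =>
    hxo ⟨⟨hxM, hx⟩, fun y hy => (not_lt.1 hlt).trans (hz.2 y hy)⟩
  have hφpos : 0 < φ x := (hφ x).lt_of_ne fun h => hxM ((hφ0 x).1 h.symm)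
  obtain ⟨e, he0, he⟩ := EReal.lt_iff_exists_real_btwn.1 hφpos
  obtain ⟨m, -, hm⟩ := EReal.lt_iff_exists_real_btwn.1 (bot_lt_iff_ne_bot.2 (hfbot x))
  have he0' : 0 < e := by exact_mod_cast he0
  lift f z to ℝ using ⟨hztop, hfbot z⟩ with a
  refine ⟨max 1 ((a - m) / e), lt_max_of_lt_left one_pos, ?_⟩
  filter_upwards [hf x hx _ hm, hφlsc x hx _ he] with y hym hye
  set c := max 1 ((a - m) / e)
  have hc : (0 : EReal) ≤ c := by
    exact_mod_cast zero_le_one.trans (le_max_left 1 ((a - m) / e))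
  have hce : a ≤ m + c * e := by
    have := (div_le_iff₀ he0').1 (le_max_right 1 ((a - m) / e))
    linarith
  calc (a : EReal) ≤ (m : EReal) + c * e := by exact_mod_cast hce
    _ ≤ f y + c * φ y := add_le_add hym.le (mul_le_mul_of_nonneg_left hye.le hc)

/-- On a compact subset of `A`, a single penalty parameter suffices in
`exists_eventually_le_linPen`. -/
lemma IsCompact.exists_le_linPen {X : Type*} [TopologicalSpace X] {f φ : X → EReal}
    {M A K : Set X} (hK : IsCompact K) (hKA : K ⊆ A)
    (hfbot : ∀ x, f x ≠ ⊥) (hφ : ∀ x, 0 ≤ φ x) (hφ0 : ∀ x, φ x = 0 ↔ x ∈ M)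
    (hf : LowerSemicontinuousOn f A) (hφlsc : LowerSemicontinuousOn φ A)
    {z : X} (hz : z ∈ optSet f M A) (hztop : f z ≠ ⊤)
    (hloc : ∀ x₀ ∈ optSet f M A, LocallyExact A (linPen f φ) x₀) :
    ∃ c > (0 : ℝ), ∀ y ∈ K, f z ≤ linPen f φ y c := by
  refine hK.induction_on (p := fun s => ∃ c > (0 : ℝ), ∀ y ∈ s, f z ≤ linPen f φ y c)
    ⟨1, one_pos, by simp⟩ ?_ ?_ ?_
  · rintro s t hst ⟨c, hc, h⟩
    exact ⟨c, hc, fun y hy => h y (hst hy)⟩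
  · rintro s t ⟨c, hc, h⟩ ⟨d, hd, h'⟩
    refine ⟨max c d, lt_max_of_lt_left hc, ?_⟩
    rintro y (hy | hy)
    · exact (h y hy).trans (linPen_mono f φ (hφ y) (le_max_left c d))
    · exact (h' y hy).trans (linPen_mono f φ (hφ y) (le_max_right c d))
  · intro x hx
    obtain ⟨c, hc, h⟩ :=
      exists_eventually_le_linPen hfbot hφ hφ0 hf hφlsc hz hztop hloc (hKA hx)
    exact ⟨_, nhdsWithin_mono x hKA h, c, hc, fun y hy => hy⟩

/-- If the penalty function is bounded below on `A` by the optimal value for some penalty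
parameter, then it is globally exact. -/
lemma globallyExact_linPen_of_le {X : Type*} {f φ : X → EReal} {M A : Set X}
    (hfbot : ∀ x, f x ≠ ⊥) (hφ : ∀ x, 0 ≤ φ x) (hφ0 : ∀ x, φ x = 0 ↔ x ∈ M)
    {z : X} (hz : z ∈ optSet f M A) (hztop : f z ≠ ⊤) {c₀ : ℝ} (hc₀ : 0 < c₀)
    (h : ∀ y ∈ A, f z ≤ linPen f φ y c₀) : GloballyExact f M A (linPen f φ) := by
  refine ⟨c₀ + 1, by linarith, fun c hc => ?_⟩
  have hlt : c₀ < c := by linarith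
  ext x
  constructor
  · rintro ⟨hxA, hx⟩
    have hxz : linPen f φ x c ≤ f z := by
      simpa only [linPen_of_mem_zero f φ ((hφ0 z).2 hz.1.1)] using hx z hz.1.2
    have hx0 : φ x = 0 := by
      by_contra hne
      exact (lt_linPen_of_le_linPen hztop (hfbot x) ((hφ x).lt_of_ne (Ne.symm hne)) hc₀ hlt
        (h x hxA)).not_ge hxz
    rw [linPen_of_mem_zero f φ hx0] at hxz
    exact ⟨⟨(hφ0 x).1 hx0, hxA⟩, fun y hy => hxz.trans (hz.2 y hy)⟩
  · rintro ⟨⟨hxM, hxA⟩, hx⟩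
    refine ⟨hxA, fun y hy => ?_⟩
    simp only [linPen_of_mem_zero f φ ((hφ0 x).2 hxM)]
    exact (hx z hz.1).trans ((h y hy).trans (linPen_mono f φ (hφ y) hlt.le))

/-- Localization Principle for Linear Penalty Functions. -/
theorem localization_principle_linear_penalty
    {X : Type*} [NormedAddCommGroup X] [NormedSpace ℝ X] [FiniteDimensional ℝ X]
    (f : X → EReal) (φ : X → EReal) (M A : Set X)
    (hM : M.Nonempty) (hA : A.Nonempty)
    (hfbot : ∀ x, f x ≠ ⊥)
    (hφ : ∀ x, 0 ≤ φ x) (hφ0 : ∀ x, φ x = 0 ↔ x ∈ M)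
    (hfeas : ∃ x ∈ M ∩ A, f x < ⊤)
    (hopt : (optSet f M A).Nonempty)
    (hAcl : IsClosed A) (hΩ : IsClosed (M ∩ A))
    (hf : LowerSemicontinuousOn f A) (hφlsc : LowerSemicontinuousOn φ A) :
    GloballyExact f M A (linPen f φ) ↔
      (∀ x₀ ∈ optSet f M A, LocallyExact A (linPen f φ) x₀) ∧
      (NonDegenerate A (linPen f φ) ∨
        ∃ c₀ > (0 : ℝ),
          Bornology.IsBounded {x ∈ A | linPen f φ x c₀ < sInf (f '' (M ∩ A))}) := by
  obtain ⟨z, hz⟩ := hopt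
  have hztop : f z ≠ ⊤ := by
    obtain ⟨x, hx, hxtop⟩ := hfeas
    exact ((hz.2 x hx).trans_lt hxtop).ne
  have hinf : sInf (f '' (M ∩ A)) = f z :=
    IsLeast.csInf_eq ⟨mem_image_of_mem f hz.1, forall_mem_image.2 hz.2⟩
  rw [hinf]
  constructor
  · rintro ⟨c₀, hc₀, h⟩
    refine ⟨fun x hx => ⟨c₀, hc₀, univ, univ_mem, fun c hc y hy => ?_⟩,
      Or.inl ⟨c₀, hc₀, ‖z‖ + 1, by positivity, fun c hc => ⟨z, ?_, by linarith⟩⟩⟩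
    · rw [← h c hc] at hx
      exact hx.2 y hy.2
    · rwa [h c hc]
  · rintro ⟨hloc, hbdd⟩
    have key (R : ℝ) : ∃ c > (0 : ℝ), ∀ y ∈ A ∩ Metric.closedBall 0 R,
        f z ≤ linPen f φ y c :=
      ((isCompact_closedBall 0 R).inter_left hAcl).exists_le_linPen inter_subset_left
        hfbot hφ hφ0 hf hφlsc hz hztop hloc
    rcases hbdd with ⟨c₀, hc₀, R, hR, h⟩ | ⟨c₀, hc₀, h⟩
    · obtain ⟨c, hc, hle⟩ := key R
      obtain ⟨x, ⟨hxA, hx⟩, hxR⟩ := h (max c₀ c) (le_max_left _ _)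
      refine globallyExact_linPen_of_le hfbot hφ hφ0 hz hztop (lt_max_of_lt_left hc₀)
        fun y hy => le_trans ?_ (hx y hy)
      exact (hle x ⟨hxA, mem_closedBall_zero_iff.2 hxR⟩).trans
        (linPen_mono f φ (hφ x) (le_max_right _ _))
    · obtain ⟨R, hR⟩ := h.subset_closedBall 0
      obtain ⟨c, hc, hle⟩ := key R
      refine globallyExact_linPen_of_le hfbot hφ hφ0 hz hztop (lt_max_of_lt_left hc₀)
        (c₀ := max c₀ c) fun y hy => ?_
      by_cases hlt : linPen f φ y c₀ < f z
      · exact (hle y ⟨hy, hR ⟨hy, hlt⟩⟩).trans (linPen_mono f φ (hφ y) (le_max_right _ _))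
      · exact (not_lt.1 hlt).trans (linPen_mono f φ (hφ y) (le_max_left _ _))
end

section
/- Let the set A be closed, and let the functions f, φ and F(·,c) (for every c > 0) be lower semicontinuous on A. Suppose also that Q(0,s) → +∞ as s → +∞. Then the nonlinear penalty function F(x,c) = Q(f(x), cφ(x)) is globally exact if and only if it is locally exact at every globally optimal solution of the problem (P) and one of the following two conditions is satisfied: (1) F is non-degenerate; (2) there exists c₀ > 0 such that the set {x ∈ A : Q(f(x), c₀φ(x)) < Q(f*,0)} is bounded. -/
open Set Filter Topology

/-- The nonlinear penalty function `F(x, c) = Q(f(x), c·φ(x))`. -/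
noncomputable def nonlinPen {X : Type*} (Q : EReal → EReal → EReal)
    (f : X → EReal) (φ : X → EReal) (x : X) (c : ℝ) : EReal :=
  Q (f x) ((c : EReal) * φ x)

/-- The standing assumptions on the convolution function
`Q : [0,+∞]² → (−∞,+∞]`: its restriction to `[0,+∞)²` is strictly monotone,
`Q(+∞, s) = Q(t, +∞) = +∞`, and `Q` never takes the value `−∞` on `[0,+∞]²`. -/
structure QAssumptions (Q : EReal → EReal → EReal) : Prop where
  mono : ∀ t₁ s₁ t₂ s₂ : EReal, 0 ≤ t₁ → 0 ≤ s₁ → t₁ ≤ t₂ → s₁ ≤ s₂ →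
    t₂ < ⊤ → s₂ < ⊤ → ¬(t₁ = t₂ ∧ s₁ = s₂) → Q t₁ s₁ < Q t₂ s₂
  top_left : ∀ s : EReal, 0 ≤ s → Q ⊤ s = ⊤
  top_right : ∀ t : EReal, 0 ≤ t → Q t ⊤ = ⊤
  ne_bot : ∀ t s : EReal, 0 ≤ t → 0 ≤ s → Q t s ≠ ⊥

theorem QAssumptions.monotone {Q : EReal → EReal → EReal} (hQ : QAssumptions Q)
    {t₁ s₁ t₂ s₂ : EReal} (ht₁ : 0 ≤ t₁) (hs₁ : 0 ≤ s₁) (ht : t₁ ≤ t₂) (hs : s₁ ≤ s₂) :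
    Q t₁ s₁ ≤ Q t₂ s₂ := by
  rcases eq_or_ne t₂ ⊤ with rfl | ht₂
  · simp [hQ.top_left s₂ (hs₁.trans hs)]
  rcases eq_or_ne s₂ ⊤ with rfl | hs₂
  · simp [hQ.top_right t₂ (ht₁.trans ht)]
  by_cases h : t₁ = t₂ ∧ s₁ = s₂
  · rw [h.1, h.2]
  · exact (hQ.mono t₁ s₁ t₂ s₂ ht₁ hs₁ ht hs ht₂.lt_top hs₂.lt_top h).le

theorem QAssumptions.lt_top {Q : EReal → EReal → EReal} (hQ : QAssumptions Q)
    {t : EReal} (ht₀ : 0 ≤ t) (ht : t < ⊤) : Q t 0 < ⊤ :=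
  (hQ.mono t 0 t 1 ht₀ le_rfl le_rfl zero_le_one ht (EReal.coe_lt_top 1) (by simp)).trans_le
    le_top

section

variable {X : Type*} {Q : EReal → EReal → EReal} {f φ : X → EReal} {M A : Set X}

theorem nonlinPen_of_mem (hφ0 : ∀ x, φ x = 0 ↔ x ∈ M) {x : X} (hx : x ∈ M) (c : ℝ) :
    nonlinPen Q f φ x c = Q (f x) 0 := by
  rw [nonlinPen, (hφ0 x).2 hx, mul_zero]

theorem nonlinPen_mono (hQ : QAssumptions Q) {x : X} (hf : 0 ≤ f x) (hφ : 0 ≤ φ x)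
    {c d : ℝ} (hc : 0 ≤ c) (hcd : c ≤ d) : nonlinPen Q f φ x c ≤ nonlinPen Q f φ x d :=
  hQ.monotone hf (mul_nonneg (EReal.coe_nonneg.2 hc) hφ) le_rfl
    (mul_le_mul_of_nonneg_right (EReal.coe_le_coe_iff.2 hcd) hφ)

theorem nonlinPen_lt (hQ : QAssumptions Q) {x : X} (hf : 0 ≤ f x) (hφ : 0 < φ x)
    {c d : ℝ} (hc : 0 < c) (hcd : c < d) (h : nonlinPen Q f φ x d < ⊤) :
    nonlinPen Q f φ x c < nonlinPen Q f φ x d := by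
  have hd : 0 < d := hc.trans hcd
  have hf' : f x ≠ ⊤ := fun e => by
    rw [nonlinPen, e, hQ.top_left _ (mul_nonneg (EReal.coe_nonneg.2 hd.le) hφ.le)] at h
    exact h.ne rfl
  have hφ' : φ x ≠ ⊤ := fun e => by
    rw [nonlinPen, e, EReal.coe_mul_top_of_pos hd, hQ.top_right _ hf] at h
    exact h.ne rfl
  unfold nonlinPen
  lift φ x to ℝ using ⟨hφ', hφ.ne_bot⟩ with r
  have hr : 0 < r := EReal.coe_pos.1 hφ
  have hlt : c * r < d * r := mul_lt_mul_of_pos_right hcd hr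
  rw [← EReal.coe_mul, ← EReal.coe_mul]
  exact hQ.mono _ _ _ _ hf (EReal.coe_nonneg.2 (by positivity)) le_rfl
    (EReal.coe_le_coe_iff.2 hlt.le) hf'.lt_top (EReal.coe_lt_top _)
    fun e => hlt.ne (EReal.coe_injective e.2)

/-- A uniform lower bound by the optimal value for all large parameters yields global
exactness. -/
theorem globallyExact_of_le (hQ : QAssumptions Q) (hfnn : ∀ x, 0 ≤ f x) (hφ : ∀ x, 0 ≤ φ x)
    (hφ0 : ∀ x, φ x = 0 ↔ x ∈ M) {z : X} (hz : z ∈ optSet f M A) (hz_top : f z < ⊤)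
    {c₀ : ℝ} (hc₀ : 0 < c₀) (h : ∀ c ≥ c₀, ∀ x ∈ A, Q (f z) 0 ≤ nonlinPen Q f φ x c) :
    GloballyExact f M A (nonlinPen Q f φ) := by
  refine ⟨c₀ + 1, by linarith, fun c hc => Subset.antisymm ?_ ?_⟩
  · rintro x ⟨hxA, hx⟩
    have hxz : nonlinPen Q f φ x c ≤ Q (f z) 0 :=
      (hx z hz.1.2).trans_eq (nonlinPen_of_mem hφ0 hz.1.1 c)
    have hxM : x ∈ M := by
      by_contra hxM
      have hpos : 0 < φ x := (hφ x).lt_of_ne fun e => hxM ((hφ0 x).1 e.symm)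
      have hlt := nonlinPen_lt hQ (hfnn x) hpos hc₀ (by linarith : c₀ < c)
        (hxz.trans_lt (hQ.lt_top (hfnn z) hz_top))
      exact ((h c₀ le_rfl x hxA).trans_lt (hlt.trans_le hxz)).false
    have hfx : f x ≤ f z := by
      by_contra! hlt
      rw [nonlinPen_of_mem hφ0 hxM] at hxz
      rcases eq_or_ne (f x) ⊤ with e | e
      · rw [e, hQ.top_left 0 le_rfl] at hxz
        exact (hxz.trans_lt (hQ.lt_top (hfnn z) hz_top)).false
      · exact hxz.not_gt <| hQ.mono _ _ _ _ (hfnn z) le_rfl hlt.le le_rfl e.lt_top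
          EReal.zero_lt_top fun e => hlt.ne e.1
    exact ⟨⟨hxM, hxA⟩, fun y hy => hfx.trans (hz.2 y hy)⟩
  · rintro x ⟨⟨hxM, hxA⟩, hx⟩
    refine ⟨hxA, fun y hy => ?_⟩
    simp only [nonlinPen_of_mem hφ0 hxM]
    exact (hQ.monotone (hfnn x) le_rfl (hx z hz.1) le_rfl).trans (h c (by linarith) y hy)

variable [TopologicalSpace X]

/-- Near every point of `A`, the penalty function is bounded below by the optimal value for
all large parameters. -/
theorem exists_nhdsWithin_le_nonlinPen (hQ : QAssumptions Q) (hfnn : ∀ x, 0 ≤ f x)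
    (hφ : ∀ x, 0 ≤ φ x) (hφ0 : ∀ x, φ x = 0 ↔ x ∈ M)
    (hf : LowerSemicontinuousOn f A) (hφlsc : LowerSemicontinuousOn φ A)
    (hQlim : Tendsto (fun s : ℝ => Q 0 (s : EReal)) atTop (𝓝 (⊤ : EReal)))
    (hloc : ∀ x₀ ∈ optSet f M A, LocallyExact A (nonlinPen Q f φ) x₀)
    {z : X} (hz : z ∈ optSet f M A) (hz_top : f z < ⊤) {x₀ : X} (hx₀ : x₀ ∈ A) :
    ∃ t ∈ 𝓝[A] x₀, ∃ c₀ > (0 : ℝ), ∀ c ≥ c₀, ∀ x ∈ t,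
      Q (f z) 0 ≤ nonlinPen Q f φ x c := by
  by_cases hM : x₀ ∈ M
  · by_cases hle : f x₀ ≤ f z
    · have hopt : x₀ ∈ optSet f M A := ⟨⟨hM, hx₀⟩, fun y hy => hle.trans (hz.2 y hy)⟩
      obtain ⟨c₀, hc₀, U, hU, h⟩ := hloc x₀ hopt
      refine ⟨U ∩ A, inter_comm U A ▸ inter_mem_nhdsWithin A hU, c₀, hc₀, fun c hc x hx => ?_⟩
      have := h c hc x hx
      rw [nonlinPen_of_mem hφ0 hM] at this
      exact (hQ.monotone (hfnn z) le_rfl (hz.2 x₀ ⟨hM, hx₀⟩) le_rfl).trans this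
    · refine ⟨_, hf x₀ hx₀ (f z) (not_le.1 hle), 1, one_pos, fun c hc x hx => ?_⟩
      exact hQ.monotone (hfnn z) le_rfl (le_of_lt hx)
        (mul_nonneg (EReal.coe_nonneg.2 (by linarith)) (hφ x))
  · have hpos : 0 < φ x₀ := (hφ x₀).lt_of_ne fun e => hM ((hφ0 x₀).1 e.symm)
    obtain ⟨r, hr₀, hr⟩ := EReal.lt_iff_exists_real_btwn.1 hpos
    have hr₀ : 0 < r := EReal.coe_pos.1 hr₀
    obtain ⟨S, hS, hS₀⟩ := ((hQlim.eventually (lt_mem_nhds (hQ.lt_top (hfnn z) hz_top))).and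
      (eventually_gt_atTop 0)).exists
    refine ⟨_, hφlsc x₀ hx₀ r hr, S / r, by positivity, fun c hc x hx => ?_⟩
    have hc' : 0 ≤ c := le_trans (by positivity) hc
    refine hS.le.trans (hQ.monotone le_rfl (EReal.coe_nonneg.2 hS₀.le) (hfnn x) ?_)
    calc (S : EReal) ≤ ((c * r : ℝ) : EReal) := EReal.coe_le_coe_iff.2 ((div_le_iff₀ hr₀).1 hc)
      _ = (c : EReal) * r := EReal.coe_mul c r
      _ ≤ c * φ x := mul_le_mul_of_nonneg_left (le_of_lt hx) (EReal.coe_nonneg.2 hc')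

theorem exists_forall_le_nonlinPen_of_isCompact (hQ : QAssumptions Q) (hfnn : ∀ x, 0 ≤ f x)
    (hφ : ∀ x, 0 ≤ φ x) (hφ0 : ∀ x, φ x = 0 ↔ x ∈ M)
    (hf : LowerSemicontinuousOn f A) (hφlsc : LowerSemicontinuousOn φ A)
    (hQlim : Tendsto (fun s : ℝ => Q 0 (s : EReal)) atTop (𝓝 (⊤ : EReal)))
    (hloc : ∀ x₀ ∈ optSet f M A, LocallyExact A (nonlinPen Q f φ) x₀)
    {z : X} (hz : z ∈ optSet f M A) (hz_top : f z < ⊤)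
    {K : Set X} (hK : IsCompact K) (hKA : K ⊆ A) :
    ∃ c₀ > (0 : ℝ), ∀ c ≥ c₀, ∀ x ∈ K, Q (f z) 0 ≤ nonlinPen Q f φ x c := by
  refine hK.induction_on
    (p := fun t => ∃ c₀ > (0 : ℝ), ∀ c ≥ c₀, ∀ x ∈ t, Q (f z) 0 ≤ nonlinPen Q f φ x c)
    ⟨1, one_pos, by simp⟩ ?_ ?_ ?_
  · rintro s t hst ⟨c₀, hc₀, h⟩
    exact ⟨c₀, hc₀, fun c hc x hx => h c hc x (hst hx)⟩
  · rintro s t ⟨c₁, hc₁, h₁⟩ ⟨c₂, -, h₂⟩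
    refine ⟨max c₁ c₂, lt_max_of_lt_left hc₁, fun c hc x hx => ?_⟩
    exact hx.elim (h₁ c (le_of_max_le_left hc) x) (h₂ c (le_of_max_le_right hc) x)
  · intro x hx
    obtain ⟨t, ht, h⟩ := exists_nhdsWithin_le_nonlinPen hQ hfnn hφ hφ0 hf hφlsc hQlim hloc hz
      hz_top (hKA hx)
    exact ⟨t, nhdsWithin_mono x hKA ht, h⟩

end

/-- Localization Principle for Nonlinear Penalty Functions. -/
theorem localization_principle_nonlinear_penalty
    {X : Type*} [NormedAddCommGroup X] [NormedSpace ℝ X] [FiniteDimensional ℝ X]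
    (Q : EReal → EReal → EReal) (f : X → EReal) (φ : X → EReal) (M A : Set X)
    (hM : M.Nonempty) (hA : A.Nonempty)
    (hQ : QAssumptions Q)
    (hfnn : ∀ x, 0 ≤ f x)
    (hφ : ∀ x, 0 ≤ φ x) (hφ0 : ∀ x, φ x = 0 ↔ x ∈ M)
    (hfeas : ∃ x ∈ M ∩ A, f x < ⊤)
    (hopt : (optSet f M A).Nonempty)
    (hAcl : IsClosed A)
    (hf : LowerSemicontinuousOn f A) (hφlsc : LowerSemicontinuousOn φ A)
    (hFlsc : ∀ c : ℝ, 0 < c →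
      LowerSemicontinuousOn (fun x => nonlinPen Q f φ x c) A)
    (hQlim : Tendsto (fun s : ℝ => Q 0 (s : EReal)) atTop (𝓝 (⊤ : EReal))) :
    GloballyExact f M A (nonlinPen Q f φ) ↔
      (∀ x₀ ∈ optSet f M A, LocallyExact A (nonlinPen Q f φ) x₀) ∧
      (NonDegenerate A (nonlinPen Q f φ) ∨
        ∃ c₀ > (0 : ℝ),
          Bornology.IsBounded
            {x ∈ A | nonlinPen Q f φ x c₀ < Q (sInf (f '' (M ∩ A))) 0}) := by
  obtain ⟨z, hz⟩ := hopt
  have hz_top : f z < ⊤ := hfeas.elim fun y hy => (hz.2 y hy.1).trans_lt hy.2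
  have hinf : sInf (f '' (M ∩ A)) = f z :=
    IsLeast.csInf_eq ⟨mem_image_of_mem f hz.1, forall_mem_image.2 hz.2⟩
  rw [hinf]
  constructor
  · rintro ⟨c₀, hc₀, h⟩
    refine ⟨fun x hx => ⟨c₀, hc₀, univ, univ_mem, fun c hc y hy => ?_⟩, .inr ⟨c₀, hc₀, ?_⟩⟩
    · rw [← h c hc] at hx
      exact hx.2 y hy.2
    · have hz' := hz
      rw [← h c₀ le_rfl] at hz'
      convert Bornology.isBounded_empty
      refine eq_empty_of_forall_notMem fun x hx => hx.2.not_ge ?_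
      exact (nonlinPen_of_mem hφ0 hz.1.1 c₀).ge.trans (hz'.2 x hx.1)
  · rintro ⟨hloc, hbdd⟩
    obtain ⟨c₁, hc₁, R, hR⟩ : ∃ c₁ > (0 : ℝ), ∃ R : ℝ, ∀ c ≥ c₁, ∀ x ∈ A,
        nonlinPen Q f φ x c < Q (f z) 0 →
          ∃ y ∈ A, ‖y‖ ≤ R ∧ nonlinPen Q f φ y c < Q (f z) 0 := by
      rcases hbdd with ⟨c₁, hc₁, R, -, h⟩ | ⟨c₁, hc₁, h⟩
      · refine ⟨c₁, hc₁, R, fun c hc x hx hlt => ?_⟩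
        obtain ⟨y, hy, hyR⟩ := h c hc
        exact ⟨y, hy.1, hyR, (hy.2 x hx).trans_lt hlt⟩
      · obtain ⟨R, hR⟩ := h.exists_norm_le
        refine ⟨c₁, hc₁, R, fun c hc x hx hlt => ⟨x, hx, hR x ⟨hx, ?_⟩, hlt⟩⟩
        exact (nonlinPen_mono hQ (hfnn x) (hφ x) hc₁.le hc).trans_lt hlt
    obtain ⟨c₂, -, h₂⟩ := exists_forall_le_nonlinPen_of_isCompact hQ hfnn hφ hφ0 hf hφlsc hQlim
      hloc hz hz_top ((isCompact_closedBall (0 : X) R).inter_left hAcl) inter_subset_left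
    refine globallyExact_of_le hQ hfnn hφ hφ0 hz hz_top (lt_max_of_lt_left hc₁ : 0 < max c₁ c₂)
      fun c hc x hx => ?_
    by_contra! hlt
    obtain ⟨y, hyA, hyR, hy⟩ := hR c (le_of_max_le_left hc) x hx hlt
    exact hy.not_ge
      (h₂ c (le_of_max_le_right hc) y ⟨hyA, mem_closedBall_zero_iff.2 hyR⟩)
end

section
/- Let x* be a locally optimal solution of the problem (P), and let f be Hölder continuous with exponent α ∈ (0,1] in a neighbourhood of x*. Suppose that there exist τ > 0 and r > 0 such that φ(x) ≥ τ·dist(x,Ω)^α for all x ∈ A with ‖x − x*‖ < r, where dist(x,Ω) = inf_{y∈Ω} ‖x − y‖. Then the linear penalty function F(x,c) = f(x) + cφ(x) is locally exact at x*. -/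
open Set Filter Topology

/-- A bound `a ≤ b + L * t ^ α` for all `t > d` close to `d` passes to the limit `t = d`. -/
theorem le_add_coe_rpow_of_forall_lt {a b : EReal} {L α d δ : ℝ} (hα : 0 ≤ α) (hδ : 0 < δ)
    (h : ∀ t, d < t → t < d + δ → a ≤ b + ((L * t ^ α : ℝ) : EReal)) :
    a ≤ b + ((L * d ^ α : ℝ) : EReal) := by
  have hcont : Continuous fun t : ℝ => b + ((L * t ^ α : ℝ) : EReal) := by
    induction b with
    | bot => simpa only [EReal.bot_add] using (continuous_const : Continuous fun _ : ℝ => (⊥ : EReal))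
    | top => simpa only [EReal.top_add_coe] using (continuous_const : Continuous fun _ : ℝ => (⊤ : EReal))
    | coe b =>
      simp only [← EReal.coe_add]
      exact continuous_coe_real_ereal.comp
        (continuous_const.add (continuous_const.mul (Real.continuous_rpow_const hα)))
  refine ge_of_tendsto (hcont.tendsto d |>.mono_left (nhdsWithin_le_nhds (s := Ioi d))) ?_
  filter_upwards [Ioo_mem_nhdsGT (lt_add_of_pos_right d hδ)] with t ht using h t ht.1 ht.2

/-- Sufficient conditions for the local exactness of the linear penalty function:
Hölder continuity of `f` near a locally optimal solution `x*` together with a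
Hölder-type error bound for the penalty term `φ` imply local exactness at `x*`. -/
theorem linear_penalty_local_exactness
    {X : Type*} [NormedAddCommGroup X] [NormedSpace ℝ X] [FiniteDimensional ℝ X]
    (f : X → EReal) (φ : X → EReal) (M A : Set X)
    (hM : M.Nonempty) (hA : A.Nonempty)
    (hφ : ∀ x, 0 ≤ φ x) (hφ0 : ∀ x, φ x = 0 ↔ x ∈ M)
    (α : ℝ) (hα : 0 < α) (hα1 : α ≤ 1)
    (xs : X)
    -- x* is a locally optimal solution of (P)
    (hxs : xs ∈ M ∩ A)
    (hlocopt : ∃ U ∈ 𝓝 xs, ∀ x ∈ U ∩ (M ∩ A), f xs ≤ f x)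
    -- f is Hölder continuous with exponent α in a neighbourhood of x*
    (hHolder : ∃ ε > (0 : ℝ), ∃ L ≥ (0 : ℝ), ∀ x ∈ Metric.ball xs ε,
      ∀ y ∈ Metric.ball xs ε, f x ≤ f y + ((L * ‖x - y‖ ^ α : ℝ) : EReal))
    -- error bound: φ(x) ≥ τ ⋅ dist(x, Ω)^α near x* on A
    (herr : ∃ τ > (0 : ℝ), ∃ r > (0 : ℝ), ∀ x ∈ A, ‖x - xs‖ < r →
      ((τ * (Metric.infDist x (M ∩ A)) ^ α : ℝ) : EReal) ≤ φ x) :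
    LocallyExact A (linPen f φ) xs := by
  obtain ⟨U, hU, hopt⟩ := hlocopt
  obtain ⟨ε, hε, L, hL, hH⟩ := hHolder
  obtain ⟨τ, hτ, r, hr, herr⟩ := herr
  obtain ⟨η, hη, hηU⟩ := Metric.mem_nhds_iff.1 hU
  obtain ⟨ρ, hρ, hρη, hρε, hρr⟩ : ∃ ρ > (0 : ℝ), 2 * ρ ≤ η ∧ 2 * ρ ≤ ε ∧ ρ ≤ r := by
    refine ⟨min (min (η / 2) (ε / 2)) r, by positivity, ?_, ?_, min_le_right _ _⟩
    · linarith [min_le_left (min (η / 2) (ε / 2)) r, min_le_left (η / 2) (ε / 2)]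
    · linarith [min_le_left (min (η / 2) (ε / 2)) r, min_le_right (η / 2) (ε / 2)]
  refine ⟨L / τ + 1, by positivity, Metric.ball xs ρ, Metric.ball_mem_nhds xs hρ, ?_⟩
  rintro c hc x ⟨hx, hxA⟩
  have hxρ : dist x xs < ρ := hx
  have hd : Metric.infDist x (M ∩ A) < ρ :=
    (Metric.infDist_le_dist_of_mem hxs).trans_lt hxρ
  have hbound : f xs ≤ f x + ((L * Metric.infDist x (M ∩ A) ^ α : ℝ) : EReal) := by
    refine le_add_coe_rpow_of_forall_lt hα.le (sub_pos.2 hd) fun t ht ht' => ?_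
    obtain ⟨y, hy, hxy⟩ := (Metric.infDist_lt_iff ⟨xs, hxs⟩).1 ht
    have hyxs : dist y xs < 2 * ρ := by
      linarith [dist_triangle_left y xs x]
    have hLt : L * ‖y - x‖ ^ α ≤ L * t ^ α := by
      rw [← dist_eq_norm, dist_comm]
      gcongr
    calc f xs ≤ f y := hopt y ⟨hηU (hyxs.trans_le hρη), hy⟩
      _ ≤ f x + ((L * ‖y - x‖ ^ α : ℝ) : EReal) :=
        hH y (hyxs.trans_le hρε) x (hxρ.trans_le (by linarith))
      _ ≤ f x + ((L * t ^ α : ℝ) : EReal) := by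
        gcongr
  have hc0 : 0 ≤ c := le_trans (by positivity) hc
  have hLc : L ≤ c * τ := (div_le_iff₀ hτ).1 (by linarith)
  have hpen : ((L * Metric.infDist x (M ∩ A) ^ α : ℝ) : EReal) ≤ (c : EReal) * φ x := by
    have hd0 : 0 ≤ Metric.infDist x (M ∩ A) ^ α := Real.rpow_nonneg Metric.infDist_nonneg α
    calc ((L * Metric.infDist x (M ∩ A) ^ α : ℝ) : EReal)
        ≤ ((c * (τ * Metric.infDist x (M ∩ A) ^ α) : ℝ) : EReal) := by
          rw [EReal.coe_le_coe_iff, ← mul_assoc]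
          gcongr
      _ = (c : EReal) * ((τ * Metric.infDist x (M ∩ A) ^ α : ℝ) : EReal) := EReal.coe_mul _ _
      _ ≤ (c : EReal) * φ x := by
        refine mul_le_mul_of_nonneg_left (herr x hxA ?_) (EReal.coe_nonneg.2 hc0)
        rw [← dist_eq_norm]
        exact hxρ.trans_le hρr
  calc linPen f φ xs c = f xs := by simp [linPen, (hφ0 xs).2 hxs.1]
    _ ≤ f x + ((L * Metric.infDist x (M ∩ A) ^ α : ℝ) : EReal) := hbound
    _ ≤ linPen f φ x c := add_le_add_right hpen (f x)
end

section
/- For the linear penalty function F(x,c) = f(x) + cφ(x): if Ω* ∩ argmin_{x∈A} F(x,c₀) ≠ ∅ for some c₀ > 0, then for every c > c₀ one has argmin_{x∈A} F(x,c) = Ω*; in particular, F is globally exact. -/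
open Set Filter Topology

theorem linPen_eq_of_eq_zero {X : Type*} {f φ : X → EReal} {x : X} (h : φ x = 0) (c : ℝ) :
    linPen f φ x c = f x := by
  simp [linPen, h]

/-- A finite lower bound for a penalized value becomes strict when the penalty parameter grows,
provided the penalty term is positive. -/
theorem lt_add_coe_mul_of_le_add_coe_mul {a b : EReal} {r c₀ c : ℝ} (ha : a ≠ ⊥) (hb : 0 < b)
    (hc₀ : 0 < c₀) (hc : c₀ < c) (h : (r : EReal) ≤ a + c₀ * b) : (r : EReal) < a + c * b := by
  have hcpos : 0 < c := hc₀.trans hc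
  induction b with
  | bot => simp at hb
  | top =>
    rw [EReal.coe_mul_top_of_pos hcpos, EReal.add_top_of_ne_bot ha]
    exact EReal.coe_lt_top r
  | coe b =>
    induction a with
    | bot => exact absurd rfl ha
    | top =>
      rw [← EReal.coe_mul, EReal.top_add_coe]
      exact EReal.coe_lt_top r
    | coe a =>
      norm_cast at *
      nlinarith [mul_lt_mul_of_pos_right hc hb]

/-- For the linear penalty function: if some globally optimal solution of (P) is a
global minimizer of `F(·, c₀)` on `A` for some `c₀ > 0`, then for every `c > c₀` the
minimizers of `F(·, c)` on `A` are exactly the globally optimal solutions of (P);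
in particular, `F` is globally exact. -/
theorem linear_penalty_intersection_implies_exactness
    {X : Type*} [NormedAddCommGroup X] [NormedSpace ℝ X] [FiniteDimensional ℝ X]
    (f : X → EReal) (φ : X → EReal) (M A : Set X)
    (hM : M.Nonempty) (hA : A.Nonempty)
    (hfbot : ∀ x, f x ≠ ⊥)
    (hφ : ∀ x, 0 ≤ φ x) (hφ0 : ∀ x, φ x = 0 ↔ x ∈ M)
    (hfeas : ∃ x ∈ M ∩ A, f x < ⊤)
    (hopt : (optSet f M A).Nonempty)
    (c₀ : ℝ) (hc₀ : 0 < c₀)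
    (hinter : (optSet f M A ∩ minimizersOn (fun x => linPen f φ x c₀) A).Nonempty) :
    (∀ c > c₀, minimizersOn (fun x => linPen f φ x c) A = optSet f M A) ∧
      GloballyExact f M A (linPen f φ) := by
  obtain ⟨z, ⟨⟨hzM, hzA⟩, hz⟩, -, hzpen⟩ := hinter
  obtain ⟨w, hw, hwtop⟩ := hfeas
  have hztop : f z ≠ ⊤ := ((hz w hw).trans_lt hwtop).ne
  have hpen : ∀ x ∈ M, ∀ c, linPen f φ x c = f x := fun x hx c =>
    linPen_eq_of_eq_zero ((hφ0 x).2 hx) c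
  have hstrict : ∀ c > c₀, ∀ x ∈ A, x ∉ M → f z < linPen f φ x c := by
    intro c hc x hxA hxM
    have hle : f z ≤ linPen f φ x c₀ := (hpen z hzM c₀).symm.trans_le (hzpen x hxA)
    rw [← EReal.coe_toReal hztop (hfbot z)] at hle ⊢
    have hφx : 0 < φ x := (hφ x).lt_of_ne fun h => hxM ((hφ0 x).1 h.symm)
    exact lt_add_coe_mul_of_le_add_coe_mul (hfbot x) hφx hc₀ hc hle
  have hmain : ∀ c > c₀, minimizersOn (fun x => linPen f φ x c) A = optSet f M A := by
    intro c hc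
    ext x
    constructor
    · rintro ⟨hxA, hx⟩
      have hxz : linPen f φ x c ≤ f z := (hx z hzA).trans_eq (hpen z hzM c)
      have hxM : x ∈ M := by
        by_contra hxM
        exact (hstrict c hc x hxA hxM).not_ge hxz
      rw [hpen x hxM] at hxz
      exact ⟨⟨hxM, hxA⟩, fun y hy => hxz.trans (hz y hy)⟩
    · rintro ⟨⟨hxM, hxA⟩, hx⟩
      refine ⟨hxA, fun y hyA => ?_⟩
      change linPen f φ x c ≤ linPen f φ y c
      rw [hpen x hxM]
      by_cases hyM : y ∈ M
      · rw [hpen y hyM]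
        exact hx y ⟨hyM, hyA⟩
      · exact (hx z ⟨hzM, hzA⟩).trans (hstrict c hc y hyA hyM).le
  exact ⟨hmain, c₀ + 1, by positivity, fun c hc => hmain c (by linarith)⟩
end

section
/- Let the set A be closed, let f and φ be lower semicontinuous on A, and suppose that Q(0,s) → +∞ as s → +∞. Then the nonlinear penalty function F(x,c) = Q(f(x), cφ(x)) is a penalty-type separating function; that is, for every increasing unbounded sequence {c_n} ⊆ (0,+∞), every sequence {x_n} with x_n ∈ argmin_{x∈A} F(x,c_n) for all n, every cluster point of {x_n} is a globally optimal solution of the problem (P). -/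
open Set Filter Topology

/-- Near a cluster point in `A` of a sequence in `A`, a lower semicontinuous function
exceeds any value below its value at the cluster point infinitely often. -/
theorem LowerSemicontinuousOn.frequently_lt_of_mapClusterPt {X : Type*} [TopologicalSpace X]
    {g : X → EReal} {A : Set X} (hg : LowerSemicontinuousOn g A) {u : ℕ → X}
    (hu : ∀ n, u n ∈ A) {x₀ : X} (hx₀ : x₀ ∈ A) (hcl : MapClusterPt x₀ atTop u)
    {y : EReal} (hy : y < g x₀) : ∃ᶠ n in atTop, y < g (u n) :=
  (hcl.frequently (eventually_nhdsWithin_iff.mp (hg x₀ hx₀ y hy))).mono fun n hn => hn (hu n)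

theorem QAssumptions.le_of_le {Q : EReal → EReal → EReal} (hQ : QAssumptions Q)
    {t t' s : EReal} (ht₀ : 0 ≤ t) (ht : t < ⊤) (ht' : 0 ≤ t') (hs : 0 ≤ s)
    (h : Q t' s ≤ Q t 0) : t' ≤ t := by
  by_contra! hlt
  have hfin : Q t' s < ⊤ := h.trans_lt (hQ.lt_top ht₀ ht)
  have ht'_top : t' ≠ ⊤ := by
    rintro rfl
    exact hfin.ne (hQ.top_left s hs)
  have hs_top : s ≠ ⊤ := by
    rintro rfl
    exact hfin.ne (hQ.top_right t' ht')
  exact h.not_gt (hQ.mono t 0 t' s ht₀ le_rfl hlt.le hs ht'_top.lt_top hs_top.lt_top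
    fun h => hlt.ne h.1)

/-- If `A` is closed, `f` and `φ` are lower semicontinuous on `A`, and
`Q(0, s) → +∞` as `s → +∞`, then the nonlinear penalty function is a penalty-type
separating function. -/
theorem nonlinear_penalty_is_penalty_type
    {X : Type*} [NormedAddCommGroup X] [NormedSpace ℝ X] [FiniteDimensional ℝ X]
    (Q : EReal → EReal → EReal) (f : X → EReal) (φ : X → EReal) (M A : Set X)
    (hM : M.Nonempty) (hA : A.Nonempty)
    (hQ : QAssumptions Q)
    (hfnn : ∀ x, 0 ≤ f x)
    (hφ : ∀ x, 0 ≤ φ x) (hφ0 : ∀ x, φ x = 0 ↔ x ∈ M)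
    (hfeas : ∃ x ∈ M ∩ A, f x < ⊤)
    (hopt : (optSet f M A).Nonempty)
    (hAcl : IsClosed A)
    (hf : LowerSemicontinuousOn f A) (hφlsc : LowerSemicontinuousOn φ A)
    (hQlim : Tendsto (fun s : ℝ => Q 0 (s : EReal)) atTop (𝓝 (⊤ : EReal))) :
    ∀ cseq : ℕ → ℝ, StrictMono cseq → (∀ n, 0 < cseq n) →
      Tendsto cseq atTop atTop →
      ∀ xseq : ℕ → X,
        (∀ n, xseq n ∈ minimizersOn (fun x => nonlinPen Q f φ x (cseq n)) A) →
        ∀ x₀ : X, MapClusterPt x₀ atTop xseq → x₀ ∈ optSet f M A := by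
  intro cseq _ hcpos hctop xseq hx x₀ hcl
  obtain ⟨xs, ⟨hxsM, hxsA⟩, hxsmin⟩ := hopt
  have hxs_fin : f xs < ⊤ := by
    obtain ⟨y, hy, hyfin⟩ := hfeas
    exact (hxsmin y hy).trans_lt hyfin
  have hxA : ∀ n, xseq n ∈ A := fun n => (hx n).1
  have hpos : ∀ n, 0 ≤ (cseq n : EReal) * φ (xseq n) := fun n =>
    mul_nonneg (EReal.coe_nonneg.mpr (hcpos n).le) (hφ _)
  have hbound : ∀ n, Q (f (xseq n)) ((cseq n : EReal) * φ (xseq n)) ≤ Q (f xs) 0 := by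
    intro n
    have h := (hx n).2 xs hxsA
    simpa only [nonlinPen, (hφ0 xs).mpr hxsM, mul_zero] using h
  have hx₀A : x₀ ∈ A := by
    by_contra hmem
    obtain ⟨n, hn⟩ := (hcl.frequently (hAcl.isOpen_compl.mem_nhds hmem)).exists
    exact hn (hxA n)
  have hfx₀ : f x₀ ≤ f xs := by
    by_contra! hlt
    obtain ⟨n, hn⟩ := (hf.frequently_lt_of_mapClusterPt hxA hx₀A hcl hlt).exists
    exact hn.not_ge (hQ.le_of_le (hfnn _) hxs_fin (hfnn _) (hpos n) (hbound n))
  have hφx₀ : φ x₀ = 0 := by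
    by_contra hne
    obtain ⟨ε, hε, hεφ⟩ :=
      EReal.lt_iff_exists_real_btwn.mp (lt_of_le_of_ne (hφ x₀) (Ne.symm hne))
    have hε_pos : 0 < ε := EReal.coe_pos.mp hε
    have hlarge : ∀ᶠ n in atTop, Q (f xs) 0 < Q 0 ((cseq n * ε : ℝ) : EReal) :=
      (hQlim.comp (hctop.atTop_mul_const hε_pos)).eventually_const_lt
        (hQ.lt_top (hfnn _) hxs_fin)
    obtain ⟨n, hn, hnlarge⟩ :=
      ((hφlsc.frequently_lt_of_mapClusterPt hxA hx₀A hcl hεφ).and_eventually hlarge).exists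
    have hcε : ((cseq n * ε : ℝ) : EReal) ≤ (cseq n : EReal) * φ (xseq n) := by
      rw [EReal.coe_mul]
      exact mul_le_mul_of_nonneg_left hn.le (EReal.coe_nonneg.mpr (hcpos n).le)
    exact hnlarge.not_ge ((hQ.monotone le_rfl
      (EReal.coe_nonneg.mpr (mul_pos (hcpos n) hε_pos).le) (hfnn _) hcε).trans (hbound n))
  exact ⟨⟨(hφ0 x₀).mp hφx₀, hx₀A⟩, fun y hy => hfx₀.trans (hxsmin y hy)⟩
end
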